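/- For every integer n ≥ 2, the Jacobi–Sobolev monic polynomials satisfy the three-term recurrence relation with polynomial coefficients q_{4,n+1}(x) q_{0,n}(x) S_{n+1}(x) = ( q_{3,n+1}(x) q_{0,n}(x) − q_{2,n}(x) q_{0,n+1}(x) ) S_n(x) + q_{1,n}(x) q_{0,n+1}(x) S_{n−1}(x). -/

import Mathlib

open Polynomial MeasureTheory Finset

noncomputable section

/-- The `k`-th derivative of a real polynomial. -/
def iterDeriv (k : ℕ) (f : Polynomial ℝ) : Polynomial ℝ := Polynomial.derivative^[k] f

/-- The Jacobi measure `dμ^{α,β}(x) = (1-x)^α (1+x)^β dx` on `[-1,1]`. -/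
def jacobiMeasure (α β : ℝ) : Measure ℝ :=
  (volume.restrict (Set.Icc (-1 : ℝ) 1)).withDensity
    fun x => ENNReal.ofReal ((1 - x) ^ α * (1 + x) ^ β)

/-- The Jacobi–Sobolev inner product
`⟨f,g⟩_S = ∫ f g dμ^{α,β} + ∑_{j=1}^N ∑_{k=0}^{d_j} λ_{j,k} f^{(k)}(c_j) g^{(k)}(c_j)`. -/
def sobolevIP (α β : ℝ) {N : ℕ} (c : Fin N → ℝ) (dd : Fin N → ℕ)
    (lam : Fin N → ℕ → ℝ) (f g : Polynomial ℝ) : ℝ :=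
  (∫ x, f.eval x * g.eval x ∂(jacobiMeasure α β)) +
    ∑ j : Fin N, ∑ k ∈ Finset.range (dd j + 1),
      lam j k * (iterDeriv k f).eval (c j) * (iterDeriv k g).eval (c j)

/-- The degree-`k` Taylor polynomial of `f` centred at `c`:
`Q_k(x,c;f) = ∑_{ν=0}^k f^{(ν)}(c)(x-c)^ν/ν!` (as a polynomial in `x`). -/
def taylorPoly (k : ℕ) (c : ℝ) (f : Polynomial ℝ) : Polynomial ℝ :=
  ∑ ν ∈ Finset.range (k + 1),
    Polynomial.C ((iterDeriv ν f).eval c / Nat.factorial ν) * (X - Polynomial.C c) ^ ν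

/-- `ρ(x) = ∏_{j=1}^N (x-c_j)^{d_j+1}`. -/
def rhoPoly {N : ℕ} (c : Fin N → ℝ) (dd : Fin N → ℕ) : Polynomial ℝ :=
  ∏ j : Fin N, (X - Polynomial.C (c j)) ^ (dd j + 1)

/-- `ρ_{j,k}(x) = ρ(x)/(x-c_j)^{k+1} = (x-c_j)^{d_j-k} ∏_{i≠j} (x-c_i)^{d_i+1}`. -/
def rhoJK {N : ℕ} (c : Fin N → ℝ) (dd : Fin N → ℕ) (j : Fin N) (k : ℕ) : Polynomial ℝ :=
  (X - Polynomial.C (c j)) ^ (dd j - k) *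
    ∏ i ∈ Finset.univ.erase j, (X - Polynomial.C (c i)) ^ (dd i + 1)

/-- `â_n(x) = -n((2n+α+β)x+β-α)/(2n+α+β)`. -/
def ahat (α β : ℝ) (n : ℕ) : Polynomial ℝ :=
  Polynomial.C (-(n : ℝ) / (2 * (n : ℝ) + α + β)) *
    (Polynomial.C (2 * (n : ℝ) + α + β) * X + Polynomial.C (β - α))

/-- `b̂_n = 4n(n+α)(n+β)(n+α+β)/((2n+α+β)²(2n+α+β-1))`. -/
def bhat (α β : ℝ) (n : ℕ) : ℝ :=
  4 * (n : ℝ) * ((n : ℝ) + α) * ((n : ℝ) + β) * ((n : ℝ) + α + β) /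
    ((2 * (n : ℝ) + α + β) ^ 2 * (2 * (n : ℝ) + α + β - 1))

/-- `ĉ_n(x) = (n+α+β)((2n+α+β)x+α-β)/(2n+α+β)`. -/
def chat (α β : ℝ) (n : ℕ) : Polynomial ℝ :=
  Polynomial.C (((n : ℝ) + α + β) / (2 * (n : ℝ) + α + β)) *
    (Polynomial.C (2 * (n : ℝ) + α + β) * X + Polynomial.C (α - β))

/-- `d̂_n = -(2n+α+β-1)`. -/
def dhat (α β : ℝ) (n : ℕ) : ℝ := -(2 * (n : ℝ) + α + β - 1)

/-- `γ_{1,n} = (β²-α²)/((2n+α+β)(2n+α+β+2))`. -/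
def gamma1 (α β : ℝ) (n : ℕ) : ℝ :=
  (β ^ 2 - α ^ 2) / ((2 * (n : ℝ) + α + β) * (2 * (n : ℝ) + α + β + 2))

/-- `γ_{2,n} = 4n(n+α)(n+β)(n+α+β)/((2n+α+β)²((2n+α+β)²-1))`. -/
def gamma2 (α β : ℝ) (n : ℕ) : ℝ :=
  4 * (n : ℝ) * ((n : ℝ) + α) * ((n : ℝ) + β) * ((n : ℝ) + α + β) /
    ((2 * (n : ℝ) + α + β) ^ 2 * ((2 * (n : ℝ) + α + β) ^ 2 - 1))

/-- A continuous function is integrable against the Jacobi weight on `[-1,1]`. -/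
theorem integrableOn_jacobiWeight_mul {α β : ℝ} (hα : -1 < α) (hβ : -1 < β) {f : ℝ → ℝ}
    (hf : Continuous f) :
    IntegrableOn (fun x => (1 - x) ^ α * (1 + x) ^ β * f x) (Set.Icc (-1 : ℝ) 1) := by
  have hr : ∀ b : ℝ, -1 < b → IntervalIntegrable (fun x : ℝ => x ^ b) volume 0 1 :=
    fun b hb => intervalIntegral.intervalIntegrable_rpow' hb
  have hleft : IntegrableOn (fun x => (1 - x) ^ α * (1 + x) ^ β * f x) (Set.Icc (-1 : ℝ) 0) := by
    have h1 : IntervalIntegrable (fun x : ℝ => (1 + x) ^ β) volume (-1) 0 := by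
      simpa using (hr β hβ).comp_add_left 1
    have h2 := (intervalIntegrable_iff_integrableOn_Icc_of_le (by norm_num)).1 h1
    have h3 : ContinuousOn (fun x : ℝ => (1 - x) ^ α * f x) (Set.Icc (-1 : ℝ) 0) := by
      refine ContinuousOn.mul (ContinuousOn.rpow_const (by fun_prop) fun x hx => Or.inl ?_)
        hf.continuousOn
      have := hx.2
      linarith
    refine (h2.continuousOn_mul h3 isCompact_Icc).congr_fun (fun x _ => ?_) measurableSet_Icc
    simp only
    ring
  have hright : IntegrableOn (fun x => (1 - x) ^ α * (1 + x) ^ β * f x) (Set.Icc (0 : ℝ) 1) := by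
    have h1 : IntervalIntegrable (fun x : ℝ => (1 - x) ^ α) volume 0 1 := by
      simpa using ((hr α hα).comp_sub_left 1).symm
    have h2 := (intervalIntegrable_iff_integrableOn_Icc_of_le (by norm_num)).1 h1
    have h3 : ContinuousOn (fun x : ℝ => (1 + x) ^ β * f x) (Set.Icc (0 : ℝ) 1) := by
      refine ContinuousOn.mul (ContinuousOn.rpow_const (by fun_prop) fun x hx => Or.inl ?_)
        hf.continuousOn
      have := hx.1
      linarith
    refine (h2.continuousOn_mul h3 isCompact_Icc).congr_fun (fun x _ => ?_) measurableSet_Icc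
    simp only
    ring
  have := hleft.union hright
  rwa [Set.Icc_union_Icc_eq_Icc (by norm_num) (by norm_num)] at this

theorem jacobiWeight_nonneg (α β : ℝ) {x : ℝ} (hx : x ∈ Set.Icc (-1 : ℝ) 1) :
    0 ≤ (1 - x) ^ α * (1 + x) ^ β :=
  mul_nonneg (Real.rpow_nonneg (by linarith [hx.2]) _) (Real.rpow_nonneg (by linarith [hx.1]) _)

theorem measurable_ofReal_jacobiWeight (α β : ℝ) :
    Measurable fun x : ℝ => ENNReal.ofReal ((1 - x) ^ α * (1 + x) ^ β) := by
  fun_prop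

theorem integral_jacobiMeasure (α β : ℝ) (f : ℝ → ℝ) :
    ∫ x, f x ∂(jacobiMeasure α β) =
      ∫ x in Set.Icc (-1 : ℝ) 1, (1 - x) ^ α * (1 + x) ^ β * f x := by
  rw [jacobiMeasure, integral_withDensity_eq_integral_toReal_smul
    (measurable_ofReal_jacobiWeight α β) (by simp)]
  refine setIntegral_congr_fun measurableSet_Icc fun x hx => ?_
  simp only [smul_eq_mul]
  rw [ENNReal.toReal_ofReal (jacobiWeight_nonneg α β hx)]

/-- Integration of polynomials against the Jacobi measure, as a linear functional. -/
def jacobiFunctional (α β : ℝ) (hα : -1 < α) (hβ : -1 < β) : ℝ[X] →ₗ[ℝ] ℝ where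
  toFun f := ∫ x, f.eval x ∂(jacobiMeasure α β)
  map_add' f g := by
    simp only [integral_jacobiMeasure, eval_add, mul_add]
    exact integral_add (integrableOn_jacobiWeight_mul hα hβ f.continuous)
      (integrableOn_jacobiWeight_mul hα hβ g.continuous)
  map_smul' r f := by
    simp only [eval_smul, smul_eq_mul, RingHom.id_apply, integral_const_mul]

theorem jacobiFunctional_mul_self_pos {α β : ℝ} (hα : -1 < α) (hβ : -1 < β) {f : ℝ[X]}
    (hf : f ≠ 0) : 0 < jacobiFunctional α β hα hβ (f * f) := by
  change 0 < ∫ x, (f * f).eval x ∂(jacobiMeasure α β)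
  rw [integral_jacobiMeasure, setIntegral_pos_iff_support_of_nonneg_ae]
  · have hsub : Set.Ioo (-1 : ℝ) 1 \ f.roots.toFinset ⊆
        (Function.support fun x => (1 - x) ^ α * (1 + x) ^ β * (f * f).eval x) ∩
          Set.Icc (-1 : ℝ) 1 := by
      rintro x ⟨hx, hroot⟩
      refine ⟨?_, Set.Ioo_subset_Icc_self hx⟩
      have hfx : f.eval x ≠ 0 := by simpa [hf] using hroot
      have h1 : 0 < (1 - x) ^ α := Real.rpow_pos_of_pos (by linarith [hx.2]) _
      have h2 : 0 < (1 + x) ^ β := Real.rpow_pos_of_pos (by linarith [hx.1]) _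
      simp only [Function.mem_support, eval_mul]
      positivity
    refine lt_of_lt_of_le ?_ (measure_mono hsub)
    rw [measure_sdiff_null (Finset.measure_zero _ _)]
    simp
  · filter_upwards [ae_restrict_mem measurableSet_Icc] with x hx
    rw [Pi.zero_apply, eval_mul]
    exact mul_nonneg (jacobiWeight_nonneg α β hx) (mul_self_nonneg _)
  · exact integrableOn_jacobiWeight_mul hα hβ (f * f).continuous

/-- The Pearson equation of the Jacobi weight, tested against constants. -/
theorem jacobiFunctional_pearson {α β : ℝ} (hα : -1 < α) (hβ : -1 < β) :
    jacobiFunctional α β hα hβ (C (β - α) - C (α + β + 2) * X) = 0 := by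
  change ∫ x, (C (β - α) - C (α + β + 2) * X : ℝ[X]).eval x ∂(jacobiMeasure α β) = 0
  have hint := integrableOn_jacobiWeight_mul hα hβ (C (β - α) - C (α + β + 2) * X : ℝ[X]).continuous
  rw [integral_jacobiMeasure, integral_Icc_eq_integral_Ioc,
    ← intervalIntegral.integral_of_le (by norm_num),
    intervalIntegral.integral_eq_sub_of_hasDerivAt_of_le
      (f := fun x => (1 - x) ^ (α + 1) * (1 + x) ^ (β + 1)) (by norm_num)]
  · simp [Real.zero_rpow (show α + 1 ≠ 0 by linarith), Real.zero_rpow (show β + 1 ≠ 0 by linarith)]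
  · refine ContinuousOn.mul (ContinuousOn.rpow_const (by fun_prop) fun x hx => Or.inr (by linarith))
      (ContinuousOn.rpow_const (by fun_prop) fun x hx => Or.inr (by linarith))
  · intro x hx
    have hx1 : 0 < 1 - x := by linarith [hx.2]
    have hx2 : 0 < 1 + x := by linarith [hx.1]
    have h1 := ((hasDerivAt_id x).const_sub 1).rpow_const (p := α + 1) (Or.inl hx1.ne')
    have h2 := ((hasDerivAt_id x).const_add 1).rpow_const (p := β + 1) (Or.inl hx2.ne')
    refine (h1.mul h2).congr_deriv ?_
    simp only [id, eval_sub, eval_mul, eval_C, eval_X, add_sub_cancel_right,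
      Real.rpow_add_one hx1.ne', Real.rpow_add_one hx2.ne']
    ring
  · exact (intervalIntegrable_iff_integrableOn_Icc_of_le (by norm_num)).2 hint

/-- The linear functional `f ↦ f^{(k)}(c)`. -/
def derivEval (k : ℕ) (c : ℝ) : ℝ[X] →ₗ[ℝ] ℝ := leval c ∘ₗ derivative ^ k

theorem derivEval_apply (k : ℕ) (c : ℝ) (f : ℝ[X]) :
    derivEval k c f = (iterDeriv k f).eval c := by
  simp [derivEval, iterDeriv, Module.End.pow_apply, leval]

theorem derivEval_X_mul (k : ℕ) (c : ℝ) (f : ℝ[X]) :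
    derivEval k c (X * f) = c * derivEval k c f + k * derivEval (k - 1) c f := by
  have hX : ∀ k, iterDeriv k (X * f) = X * iterDeriv k f + (k : ℝ[X]) * iterDeriv (k - 1) f := by
    intro k
    induction k with
    | zero => simp [iterDeriv]
    | succ k ih =>
      have hs : ∀ (k : ℕ) (g : ℝ[X]), iterDeriv (k + 1) g = derivative (iterDeriv k g) :=
        fun k g => Function.iterate_succ_apply' _ _ _
      rw [hs, ih, hs]
      rcases k with _ | k
      · simp
        ring
      · simp [hs]
        ring
  simp [derivEval_apply, hX]

/-- A functional vanishing on monic polynomials of degrees `0, …, m-1` vanishes on all polynomials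
of degree less than `m`. -/
theorem map_eq_zero_of_degree_lt {P : ℕ → ℝ[X]} (hPm : ∀ i, (P i).Monic)
    (hPd : ∀ i, (P i).natDegree = i) (φ : ℝ[X] →ₗ[ℝ] ℝ) {m : ℕ} (hφ : ∀ i < m, φ (P i) = 0)
    {f : ℝ[X]} (hf : f.degree < m) : φ f = 0 := by
  induction m generalizing f with
  | zero =>
    have : f = 0 := by simpa using hf
    simp [this]
  | succ m ih =>
    have hle : f.natDegree ≤ m := natDegree_le_iff_coeff_eq_zero.2 fun i hi =>
      (degree_lt_iff_coeff_zero _ _).1 hf i hi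
    have hg : (f - C (f.coeff m) * P m).degree < m := by
      rw [degree_lt_iff_coeff_zero]
      intro i hi
      rcases hi.eq_or_lt with rfl | hi
      · have h1 : (P m).coeff m = 1 := by
          have := (hPm m).coeff_natDegree
          rwa [hPd] at this
        simp [h1]
      · have h1 : (P m).coeff i = 0 := coeff_eq_zero_of_natDegree_lt (by rwa [hPd])
        simp [h1, coeff_eq_zero_of_natDegree_lt (hle.trans_lt hi)]
    have h0 := ih (fun i hi => hφ i (hi.trans m.lt_succ_self)) hg
    rwa [map_sub, ← smul_eq_C_mul, map_smul, hφ m m.lt_succ_self, smul_zero, sub_zero] at h0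

/-- The sum `∑_{i<m} P_i^{(k)}(c) P_i / h_i`: a derivative of the Christoffel–Darboux kernel. -/
def kernelDeriv (P : ℕ → ℝ[X]) (h : ℕ → ℝ) (m k : ℕ) (c : ℝ) : ℝ[X] :=
  ∑ i ∈ range m, C (derivEval k c (P i) / h i) * P i

/-- The Christoffel–Darboux formula, differentiated `k` times in the second variable. -/
theorem X_sub_C_mul_kernelDeriv {P : ℕ → ℝ[X]} (hPm : ∀ i, (P i).Monic)
    (hPd : ∀ i, (P i).natDegree = i) {h γ₁ γ₂ : ℕ → ℝ} (hh : ∀ i, h i ≠ 0)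
    (hγ : ∀ i, γ₂ (i + 1) * h i = h (i + 1))
    (hrec : ∀ i, X * P (i + 1) = P (i + 2) + C (γ₁ (i + 1)) * P (i + 1) + C (γ₂ (i + 1)) * P i)
    (m k : ℕ) (c : ℝ) :
    (X - C c) * kernelDeriv P h (m + 1) k c - (k : ℝ[X]) * kernelDeriv P h (m + 1) (k - 1) c =
      C (1 / h m) * (C (derivEval k c (P m)) * P (m + 1) - C (derivEval k c (P (m + 1))) * P m) := by
  induction m with
  | zero =>
    have h0 : P 0 = 1 := (hPm 0).natDegree_eq_zero.1 (hPd 0)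
    obtain ⟨a, ha⟩ : ∃ a, P 1 = X + C a := by
      refine ⟨(P 1).coeff 0, ?_⟩
      have := (hPm 1).as_sum
      simpa [hPd, add_comm] using this
    have hd : ∀ (k : ℕ) (a : ℝ), derivEval (k + 1) c (C a) = 0 := fun k a => by
      simp [derivEval_apply, iterDeriv]
    have hX := derivEval_X_mul k c 1
    rw [mul_one] at hX
    have h1 : derivEval k c 1 = if k = 0 then 1 else 0 := by
      rcases k with _ | k
      · simp [derivEval_apply, iterDeriv]
      · simpa using hd k 1
    simp only [kernelDeriv, zero_add, sum_range_one, h0, ha, map_add, hX, mul_one]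
    rcases k with _ | k
    · simp [derivEval_apply, iterDeriv]
      ring
    · simp only [h1, hd, div_eq_mul_inv, C_mul]
      simp
      ring
  | succ m ih =>
    have hX : c * derivEval k c (P (m + 1)) + k * derivEval (k - 1) c (P (m + 1)) =
        derivEval k c (P (m + 2)) + γ₁ (m + 1) * derivEval k c (P (m + 1)) +
          γ₂ (m + 1) * derivEval k c (P m) := by
      rw [← derivEval_X_mul, hrec, map_add, map_add, ← smul_eq_C_mul, ← smul_eq_C_mul, map_smul,
        map_smul, smul_eq_mul, smul_eq_mul]
    have hXC := congrArg (C : ℝ → ℝ[X]) hX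
    have hγC : C (γ₂ (m + 1)) * C (1 / h (m + 1)) = (C (1 / h m) : ℝ[X]) := by
      rw [← C_mul, ← hγ]
      congr 1
      have := hh m
      have h2 : γ₂ (m + 1) ≠ 0 := fun h0 => hh (m + 1) (by rw [← hγ, h0, zero_mul])
      field_simp
    have hsucc : ∀ k, kernelDeriv P h (m + 2) k c = kernelDeriv P h (m + 1) k c +
        C (derivEval k c (P (m + 1))) * C (1 / h (m + 1)) * P (m + 1) := fun k => by
      rw [kernelDeriv, sum_range_succ, ← C_mul, mul_one_div, kernelDeriv]
    simp only [C_add, C_mul, C_eq_natCast] at hXC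
    rw [hsucc, hsucc]
    linear_combination ih + C (derivEval k c (P (m + 1))) * C (1 / h (m + 1)) * hrec m -
      C (1 / h (m + 1)) * P (m + 1) * hXC -
      (C (derivEval k c (P m)) * P (m + 1) - C (derivEval k c (P (m + 1))) * P m) * hγC

/-- Closed form of the derivatives of the Christoffel–Darboux kernel via Taylor polynomials. -/
theorem X_sub_C_pow_mul_kernelDeriv {P : ℕ → ℝ[X]} (hPm : ∀ i, (P i).Monic)
    (hPd : ∀ i, (P i).natDegree = i) {h γ₁ γ₂ : ℕ → ℝ} (hh : ∀ i, h i ≠ 0)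
    (hγ : ∀ i, γ₂ (i + 1) * h i = h (i + 1))
    (hrec : ∀ i, X * P (i + 1) = P (i + 2) + C (γ₁ (i + 1)) * P (i + 1) + C (γ₂ (i + 1)) * P i)
    (m k : ℕ) (c : ℝ) :
    (X - C c) ^ (k + 1) * kernelDeriv P h (m + 1) k c =
      C (k.factorial / h m) *
        (taylorPoly k c (P m) * P (m + 1) - taylorPoly k c (P (m + 1)) * P m) := by
  have hcd := fun k => X_sub_C_mul_kernelDeriv hPm hPd hh hγ hrec m k c
  induction k with
  | zero =>
    have := hcd 0
    simp only [CharP.cast_eq_zero, zero_mul, sub_zero] at this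
    simpa [taylorPoly, derivEval_apply] using this
  | succ k ih =>
    have ht : ∀ f : ℝ[X], taylorPoly (k + 1) c f = taylorPoly k c f +
        C (derivEval (k + 1) c f / (k + 1).factorial) * (X - C c) ^ (k + 1) := fun f => by
      rw [derivEval_apply, taylorPoly, sum_range_succ, taylorPoly]
    have hk := hcd (k + 1)
    have hf : ∀ a : ℝ, C ((k + 1).factorial / h m) * C (a / (k + 1).factorial) =
        (C (1 / h m) * C a : ℝ[X]) := fun a => by
      rw [← C_mul, ← C_mul]
      congr 1
      have := hh m
      field_simp
    have hf' : (C ((k + 1).factorial / h m) : ℝ[X]) =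
        ((k + 1 : ℕ) : ℝ[X]) * C (k.factorial / h m) := by
      rw [← C_eq_natCast, ← C_mul, Nat.factorial_succ]
      congr 1
      push_cast
      ring
    simp only [Nat.add_sub_cancel] at hk
    rw [ht, ht]
    linear_combination (X - C c) ^ (k + 1) * hk + ((k + 1 : ℕ) : ℝ[X]) * ih -
      (taylorPoly k c (P m) * P (m + 1) - taylorPoly k c (P (m + 1)) * P m) * hf' -
      (X - C c) ^ (k + 1) * P (m + 1) * hf (derivEval (k + 1) c (P m)) +
      (X - C c) ^ (k + 1) * P m * hf (derivEval (k + 1) c (P (m + 1)))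

/-- The recurrence coefficient `γ₂` is the ratio of consecutive squared norms. -/
theorem gamma_mul_norm {P : ℕ → ℝ[X]} (hPm : ∀ i, (P i).Monic) (hPd : ∀ i, (P i).natDegree = i)
    (I : ℝ[X] →ₗ[ℝ] ℝ) (hPo : ∀ i l, i ≠ l → I (P i * P l) = 0) {i : ℕ} {g₁ g₂ : ℝ}
    (hrec : X * P (i + 1) = P (i + 2) + C g₁ * P (i + 1) + C g₂ * P i) :
    g₂ * I (P i * P i) = I (P (i + 1) * P (i + 1)) := by
  have h1 : I (X * P (i + 1) * P i) = g₂ * I (P i * P i) := by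
    rw [hrec, add_mul, add_mul, map_add, map_add, mul_assoc, mul_assoc, ← smul_eq_C_mul,
      ← smul_eq_C_mul, map_smul, map_smul, hPo _ _ (by omega), hPo _ _ (by omega)]
    simp
  have h2 : I ((X * P i - P (i + 1)) * P (i + 1)) = 0 := by
    refine map_eq_zero_of_degree_lt (m := i + 1) hPm hPd (I ∘ₗ LinearMap.mulRight ℝ (P (i + 1)))
      (fun l hl => by simpa using hPo l (i + 1) hl.ne) ?_
    have hX : (X * P i).degree = ((i + 1 : ℕ) : WithBot ℕ) := by
      rw [degree_eq_natDegree (monic_X.mul (hPm i)).ne_zero,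
        monic_X.natDegree_mul (hPm i), hPd, natDegree_X, add_comm]
    rw [← hX]
    refine degree_sub_lt_left ?_ ?_ ?_
    · rw [hX, degree_eq_natDegree (hPm _).ne_zero, hPd]
    · exact (monic_X.mul (hPm i)).ne_zero
    · rw [(monic_X.mul (hPm i)).leadingCoeff, (hPm _).leadingCoeff]
  rw [sub_mul, map_sub, sub_eq_zero] at h2
  rw [← h1, ← h2]
  congr 1
  ring

section JacobiStructure

variable {α β : ℝ} {n : ℕ}

theorem X_sub_gamma1_mul_bhat (h0 : 2 * (n : ℝ) + α + β ≠ 0) (h1 : 2 * (n : ℝ) + α + β - 1 ≠ 0)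
    (h2 : 2 * (n : ℝ) + α + β + 1 ≠ 0) (h3 : 2 * (n : ℝ) + α + β + 2 ≠ 0) :
    (X - C (gamma1 α β n)) * C (bhat α β n) =
      C (gamma2 α β n) * (chat α β n - ahat α β (n + 1)) := by
  have h3' : 2 * ((n : ℝ) + 1) + α + β ≠ 0 := by convert h3 using 1; ring
  have h4 : (2 * (n : ℝ) + α + β) ^ 2 - 1 ≠ 0 := by
    convert mul_ne_zero h1 h2 using 1; ring
  refine Polynomial.funext fun x => ?_
  simp only [gamma1, gamma2, bhat, chat, ahat, eval_sub, eval_mul, eval_C, eval_X, eval_add,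
    Nat.cast_add, Nat.cast_one]
  field_simp
  ring

theorem X_sub_gamma1_mul_ahat (h0 : 2 * (n : ℝ) + α + β ≠ 0) (h1 : 2 * (n : ℝ) + α + β - 1 ≠ 0)
    (h2 : 2 * (n : ℝ) + α + β + 1 ≠ 0) (h3 : 2 * (n : ℝ) + α + β + 2 ≠ 0) :
    (X - C (gamma1 α β n)) * ahat α β n + (1 - X ^ 2) - C (gamma2 α β n) * C (dhat α β n) =
      ahat α β (n + 1) * (X - C (gamma1 α β n)) + C (bhat α β (n + 1)) := by
  have h3' : 2 * ((n : ℝ) + 1) + α + β ≠ 0 := by convert h3 using 1; ring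
  have h2' : 2 * ((n : ℝ) + 1) + α + β - 1 ≠ 0 := by convert h2 using 1; ring
  have h4 : (2 * (n : ℝ) + α + β) ^ 2 - 1 ≠ 0 := by
    convert mul_ne_zero h1 h2 using 1; ring
  refine Polynomial.funext fun x => ?_
  simp only [gamma1, gamma2, bhat, dhat, ahat, eval_sub, eval_mul, eval_C, eval_X, eval_add,
    eval_pow, eval_one, Nat.cast_add, Nat.cast_one]
  field_simp
  ring

theorem bhat_eq_neg_gamma2_mul_dhat (h0 : 2 * (n : ℝ) + α + β ≠ 0)
    (h1 : 2 * (n : ℝ) + α + β - 1 ≠ 0) (h2 : 2 * (n : ℝ) + α + β + 1 ≠ 0) :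
    bhat α β n = -(gamma2 α β n * dhat α β (n + 1)) := by
  have h4 : (2 * (n : ℝ) + α + β) ^ 2 - 1 ≠ 0 := by
    convert mul_ne_zero h1 h2 using 1; ring
  simp only [gamma2, bhat, dhat, Nat.cast_add, Nat.cast_one]
  rw [mul_neg, neg_neg, div_mul_eq_mul_div, div_eq_div_iff (by positivity) (by positivity)]
  ring

theorem ahat_eq_chat_add (h0 : 2 * (n : ℝ) + α + β ≠ 0) (h3 : 2 * (n : ℝ) + α + β + 2 ≠ 0) :
    ahat α β n = chat α β (n + 1) + C (dhat α β (n + 1)) * (X - C (gamma1 α β n)) := by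
  have h3' : 2 * ((n : ℝ) + 1) + α + β ≠ 0 := by convert h3 using 1; ring
  rw [mul_comm 2 (n : ℝ)] at h0 h3
  refine Polynomial.funext fun x => ?_
  simp only [gamma1, dhat, chat, ahat, eval_sub, eval_mul, eval_C, eval_X, eval_add,
    Nat.cast_add, Nat.cast_one]
  field_simp
  ring

/-- The structure relations of the monic Jacobi polynomials. -/
theorem jacobi_structure (hα : -1 < α) (hβ : -1 < β) (hs : α + β ≠ -1) {P : ℕ → ℝ[X]}
    (hP0 : P 0 = 1) (hP1 : P 1 = X - C ((β - α) / (α + β + 2)))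
    (hrec : ∀ i, X * P (i + 1) = P (i + 2) + C (gamma1 α β (i + 1)) * P (i + 1) +
      C (gamma2 α β (i + 1)) * P i) (m : ℕ) :
    (1 - X ^ 2) * derivative (P (m + 1)) =
        ahat α β (m + 1) * P (m + 1) + C (bhat α β (m + 1)) * P m ∧
      (1 - X ^ 2) * derivative (P m) =
        C (dhat α β (m + 1)) * P (m + 1) + chat α β (m + 1) * P m := by
  induction m with
  | zero =>
    have h2 : α + β + 2 ≠ 0 := by linarith
    have h1 : 1 + α + β ≠ 0 := fun h => hs (by linarith)
    have h2' : 2 + α + β ≠ 0 := by linarith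
    have h1' : 2 + α + β - 1 ≠ 0 := fun h => hs (by linarith)
    rw [zero_add, hP0, hP1]
    constructor
    · refine Polynomial.funext fun x => ?_
      simp [ahat, bhat]
      field_simp
      ring
    · refine Polynomial.funext fun x => ?_
      simp [dhat, chat]
      field_simp
      ring
  | succ m ih =>
    have hm : (0 : ℝ) ≤ m := m.cast_nonneg
    have h0 : 2 * ((m + 1 : ℕ) : ℝ) + α + β ≠ 0 := by push_cast; linarith
    have h1 : 2 * ((m + 1 : ℕ) : ℝ) + α + β - 1 ≠ 0 := by
      rcases m with _ | m
      · exact fun h => hs (by push_cast at h; linarith)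
      · push_cast at hm ⊢
        have : (0 : ℝ) ≤ m := m.cast_nonneg
        linarith
    have h2 : 2 * ((m + 1 : ℕ) : ℝ) + α + β + 1 ≠ 0 := by push_cast; linarith
    have h3 : 2 * ((m + 1 : ℕ) : ℝ) + α + β + 2 ≠ 0 := by push_cast; linarith
    have hd := congrArg derivative (hrec m)
    simp only [derivative_mul, derivative_X, derivative_add, derivative_C, zero_mul, one_mul,
      zero_add] at hd
    have hb := congrArg (C : ℝ → ℝ[X]) (bhat_eq_neg_gamma2_mul_dhat h0 h1 h2)
    rw [C_neg, C_mul] at hb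
    constructor
    · linear_combination -(1 - X ^ 2) * hd + (X - C (gamma1 α β (m + 1))) * ih.1 -
        C (gamma2 α β (m + 1)) * ih.2 + P m * X_sub_gamma1_mul_bhat h0 h1 h2 h3 +
        P (m + 1) * X_sub_gamma1_mul_ahat h0 h1 h2 h3 + ahat α β (m + 1 + 1) * hrec m
    · linear_combination ih.1 + P m * hb + P (m + 1) * ahat_eq_chat_add h0 h3 +
        C (dhat α β (m + 1 + 1)) * hrec m

end JacobiStructure

/-- Christoffel–Darboux expansion of the Sobolev orthogonal polynomial `S` of degree `m`. -/
theorem sobolev_eq_sub_kernelDeriv {P : ℕ → ℝ[X]} (hPm : ∀ i, (P i).Monic)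
    (hPd : ∀ i, (P i).natDegree = i) (I : ℝ[X] →ₗ[ℝ] ℝ) (hI : ∀ f, f ≠ 0 → 0 < I (f * f))
    (hPo : ∀ i l, i ≠ l → I (P i * P l) = 0) {h : ℕ → ℝ} (hh : ∀ i, h i = I (P i * P i))
    {N : ℕ} (c : Fin N → ℝ) (dd : Fin N → ℕ) (lam : Fin N → ℕ → ℝ) {m : ℕ} {S : ℝ[X]}
    (hSm : S.Monic) (hSd : S.natDegree = m)
    (hSo : ∀ l < m, I (X ^ l * S) + ∑ j, ∑ k ∈ range (dd j + 1),
      lam j k * derivEval k (c j) (X ^ l) * derivEval k (c j) S = 0) :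
    S = P m - ∑ j, ∑ k ∈ range (dd j + 1),
      C (lam j k * derivEval k (c j) S) * kernelDeriv P h m k (c j) := by
  set D := S - (P m - ∑ j, ∑ k ∈ range (dd j + 1),
      C (lam j k * derivEval k (c j) S) * kernelDeriv P h m k (c j)) with hD
  have hdeg : D.degree < m := by
    have h1 : (S - P m).degree < m := by
      have : S.degree = m := by rw [degree_eq_natDegree hSm.ne_zero, hSd]
      rw [← this]
      refine degree_sub_lt_left ?_ hSm.ne_zero ?_
      · rw [this, degree_eq_natDegree (hPm m).ne_zero, hPd]
      · rw [hSm.leadingCoeff, (hPm m).leadingCoeff]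
    have hPi : ∀ i < m, P i ∈ degreeLT ℝ m := fun i hi => by
      rw [mem_degreeLT, degree_eq_natDegree (hPm i).ne_zero, hPd]
      exact_mod_cast hi
    have hmem : D ∈ degreeLT ℝ m := by
      rw [hD, sub_sub_eq_add_sub, add_sub_right_comm]
      refine add_mem (mem_degreeLT.2 h1) (sum_mem fun j _ => sum_mem fun k _ => ?_)
      rw [← smul_eq_C_mul]
      refine Submodule.smul_mem _ _ (sum_mem fun i hi => ?_)
      rw [← smul_eq_C_mul]
      exact Submodule.smul_mem _ _ (hPi i (mem_range.1 hi))
    exact mem_degreeLT.1 hmem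
  have hSP : ∀ i < m, I (P i * S) + ∑ j, ∑ k ∈ range (dd j + 1),
      lam j k * derivEval k (c j) (P i) * derivEval k (c j) S = 0 := fun i hi => by
    have := map_eq_zero_of_degree_lt (P := fun l => X ^ l) (m := m) (f := P i)
      (fun l => monic_X_pow l) (fun l => natDegree_X_pow l)
      (I ∘ₗ LinearMap.mulRight ℝ S + ∑ j, ∑ k ∈ range (dd j + 1),
        (lam j k * derivEval k (c j) S) • derivEval k (c j))
      (fun l hl => by
        rw [← hSo l hl]
        simp [LinearMap.sum_apply, mul_right_comm]) (by
        rw [degree_eq_natDegree (hPm i).ne_zero, hPd]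
        exact_mod_cast hi)
    rw [← this]
    simp [LinearMap.sum_apply, mul_right_comm]
  have hK : ∀ i < m, ∀ k c, I (P i * kernelDeriv P h m k c) = derivEval k c (P i) := by
    intro i hi k c
    rw [kernelDeriv, mul_sum, map_sum, sum_eq_single i]
    · rw [mul_left_comm, ← smul_eq_C_mul, map_smul, ← hh, smul_eq_mul]
      refine div_mul_cancel₀ _ ?_
      rw [hh]
      exact (hI _ (hPm i).ne_zero).ne'
    · intro l _ hl
      rw [mul_left_comm, ← smul_eq_C_mul, map_smul, hPo i l hl.symm, smul_zero]
    · exact fun hi' => absurd (mem_range.2 hi) hi'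
  have hDP : ∀ i < m, I (P i * D) = 0 := fun i hi => by
    rw [← hSP i hi, hD, mul_sub, mul_sub, map_sub, map_sub, hPo i m hi.ne, mul_sum, map_sum]
    simp only [mul_sum, map_sum]
    rw [zero_sub, sub_neg_eq_add]
    congr 1
    refine sum_congr rfl fun j _ => sum_congr rfl fun k _ => ?_
    rw [mul_left_comm, ← smul_eq_C_mul, map_smul, hK i hi, smul_eq_mul]
    ring
  have hDD : I (D * D) = 0 := by
    simpa using map_eq_zero_of_degree_lt hPm hPd (I ∘ₗ LinearMap.mulRight ℝ D)
      (fun i hi => by simpa using hDP i hi) hdeg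
  by_contra hne
  exact (hI D (sub_ne_zero.2 hne)).ne' hDD

theorem rhoPoly_eq_rhoJK_mul {N : ℕ} (c : Fin N → ℝ) (dd : Fin N → ℕ) (j : Fin N) {k : ℕ}
    (hk : k ≤ dd j) : rhoPoly c dd = rhoJK c dd j k * (X - C (c j)) ^ (k + 1) := by
  rw [rhoPoly, rhoJK, ← mul_prod_erase univ _ (mem_univ j), mul_right_comm, ← pow_add,
    show dd j - k + (k + 1) = dd j + 1 by omega]

/-- The ladder equations: `f` and `g` are combinations of `p` and `q` up to the factor `r`, and so
is the derivative of `f * r`; eliminating `p` and `q` expresses `f'` through `f` and `g`. -/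
theorem ladder_equation {r f g p q w a b a' b' c d e : ℝ[X]} (hr : r ≠ 0)
    (hf : r * f = a * p + b * q) (hg : r * g = c * p + d * q)
    (hf' : w * derivative (r * f) = a' * p + b' * q) (he : a * d - b * c = r * e) :
    w * (a * d - b * c) * derivative f + (w * derivative r * e + b' * c - a' * d) * f =
      (b' * a - a' * b) * g := by
  rw [derivative_mul] at hf'
  refine mul_left_cancel₀ hr ?_
  linear_combination (a * d - b * c) * hf' - w * derivative r * f * he +
    (b' * c - a' * d) * hf - (b' * a - a' * b) * hg

/-- The connection formula expressing the Sobolev orthogonal polynomials through two consecutive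
orthogonal polynomials of the underlying functional. -/
theorem sobolev_connection {P : ℕ → ℝ[X]} (hPm : ∀ i, (P i).Monic)
    (hPd : ∀ i, (P i).natDegree = i) (I : ℝ[X] →ₗ[ℝ] ℝ) (hI : ∀ f, f ≠ 0 → 0 < I (f * f))
    (hPo : ∀ i l, i ≠ l → I (P i * P l) = 0) {h γ₁ γ₂ : ℕ → ℝ} (hh : ∀ i, h i = I (P i * P i))
    (hrec : ∀ i, X * P (i + 1) = P (i + 2) + C (γ₁ (i + 1)) * P (i + 1) + C (γ₂ (i + 1)) * P i)
    {N : ℕ} (c : Fin N → ℝ) (dd : Fin N → ℕ) (lam : Fin N → ℕ → ℝ) {m : ℕ} {S : ℝ[X]}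
    (hSm : S.Monic) (hSd : S.natDegree = m + 1)
    (hSo : ∀ l < m + 1, I (X ^ l * S) + ∑ j, ∑ k ∈ range (dd j + 1),
      lam j k * derivEval k (c j) (X ^ l) * derivEval k (c j) S = 0) :
    rhoPoly c dd * S =
      (rhoPoly c dd - ∑ j, ∑ k ∈ range (dd j + 1),
        C ((k.factorial : ℝ) * lam j k * derivEval k (c j) S / h m) *
          (taylorPoly k (c j) (P m) * rhoJK c dd j k)) * P (m + 1) +
      (∑ j, ∑ k ∈ range (dd j + 1),
        C ((k.factorial : ℝ) * lam j k * derivEval k (c j) S / h m) *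
          (taylorPoly k (c j) (P (m + 1)) * rhoJK c dd j k)) * P m := by
  have hh0 : ∀ i, h i ≠ 0 := fun i => by
    rw [hh]
    exact (hI _ (hPm i).ne_zero).ne'
  have hγ : ∀ i, γ₂ (i + 1) * h i = h (i + 1) := fun i => by
    rw [hh, hh]
    exact gamma_mul_norm hPm hPd I hPo (hrec i)
  have hS := sobolev_eq_sub_kernelDeriv hPm hPd I hI hPo hh c dd lam hSm hSd hSo
  have key : rhoPoly c dd * (∑ j, ∑ k ∈ range (dd j + 1),
      C (lam j k * derivEval k (c j) S) * kernelDeriv P h (m + 1) k (c j)) =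
      (∑ j, ∑ k ∈ range (dd j + 1),
        C ((k.factorial : ℝ) * lam j k * derivEval k (c j) S / h m) *
          (taylorPoly k (c j) (P m) * rhoJK c dd j k)) * P (m + 1) -
      (∑ j, ∑ k ∈ range (dd j + 1),
        C ((k.factorial : ℝ) * lam j k * derivEval k (c j) S / h m) *
          (taylorPoly k (c j) (P (m + 1)) * rhoJK c dd j k)) * P m := by
    simp only [mul_sum, sum_mul, ← sum_sub_distrib]
    refine sum_congr rfl fun j _ => sum_congr rfl fun k hk => ?_
    have hK := X_sub_C_pow_mul_kernelDeriv hPm hPd hh0 hγ hrec m k (c j)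
    have hC : (C ((k.factorial : ℝ) * lam j k * derivEval k (c j) S / h m) : ℝ[X]) =
        C (lam j k * derivEval k (c j) S) * C (k.factorial / h m) := by
      rw [← C_mul]
      congr 1
      ring
    rw [rhoPoly_eq_rhoJK_mul c dd j (Nat.lt_succ_iff.1 (mem_range.1 hk)), hC]
    linear_combination C (lam j k * derivEval k (c j) S) * rhoJK c dd j k * hK
  linear_combination rhoPoly c dd * hS - key

theorem stmt16 (α β : ℝ) (hα : -1 < α) (hβ : -1 < β)
    (N : ℕ) (hN : 1 ≤ N)
    (c : Fin N → ℝ) (hc : Function.Injective c) (hcout : ∀ j, c j ∉ Set.Ioo (-1 : ℝ) 1)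
    (dd : Fin N → ℕ) (hdd : Monotone dd)
    (lam : Fin N → ℕ → ℝ) (hlam : ∀ j k, 0 ≤ lam j k) (hlamd : ∀ j, 0 < lam j (dd j))
    (d : ℕ) (hd : d = ∑ j, (dd j + 1))
    (P : ℕ → Polynomial ℝ) (hPm : ∀ m, (P m).Monic) (hPd : ∀ m, (P m).natDegree = m)
    (hPo : ∀ m l, m ≠ l → ∫ x, (P m).eval x * (P l).eval x ∂(jacobiMeasure α β) = 0)
    (h : ℕ → ℝ) (hh : ∀ m, h m = ∫ x, ((P m).eval x) ^ 2 ∂(jacobiMeasure α β))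
    (S : ℕ → Polynomial ℝ) (hSm : ∀ m, (S m).Monic) (hSd : ∀ m, (S m).natDegree = m)
    (hSo : ∀ m l, l < m → sobolevIP α β c dd lam (X ^ l) (S m) = 0)
    (A2 B2 : ℕ → Polynomial ℝ)
    (hA2 : ∀ m, 1 ≤ m → A2 m = rhoPoly c dd -
      ∑ j : Fin N, ∑ k ∈ Finset.range (dd j + 1),
        Polynomial.C ((Nat.factorial k : ℝ) * lam j k * (iterDeriv k (S m)).eval (c j) / h (m - 1)) *
          (taylorPoly k (c j) (P (m - 1)) * rhoJK c dd j k))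
    (hB2 : ∀ m, 1 ≤ m → B2 m =
      ∑ j : Fin N, ∑ k ∈ Finset.range (dd j + 1),
        Polynomial.C ((Nat.factorial k : ℝ) * lam j k * (iterDeriv k (S m)).eval (c j) / h (m - 1)) *
          (taylorPoly k (c j) (P m) * rhoJK c dd j k))
    (A3 B3 : ℕ → Polynomial ℝ)
    (hA3 : ∀ m, 1 ≤ m → A3 m = (1 - X ^ 2) * Polynomial.derivative (A2 m) +
      ahat α β m * A2 m + Polynomial.C (dhat α β m) * B2 m)
    (hB3 : ∀ m, 1 ≤ m → B3 m = (1 - X ^ 2) * Polynomial.derivative (B2 m) +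
      Polynomial.C (bhat α β m) * A2 m + chat α β m * B2 m)
    (hrec : ∀ m, 1 ≤ m → X * P m =
      P (m + 1) + Polynomial.C (gamma1 α β m) * P m + Polynomial.C (gamma2 α β m) * P (m - 1))
    (C2 D2 : ℕ → Polynomial ℝ)
    (hC2 : ∀ m, 2 ≤ m → C2 m = Polynomial.C (-(1 / gamma2 α β (m - 1))) * B2 (m - 1))
    (hD2 : ∀ m, 2 ≤ m → D2 m = A2 (m - 1) +
      Polynomial.C (1 / gamma2 α β (m - 1)) * B2 (m - 1) * (X - Polynomial.C (gamma1 α β (m - 1))))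
    (C3 D3 : ℕ → Polynomial ℝ)
    (hC3 : ∀ m, 2 ≤ m → C3 m = Polynomial.C (-(1 / gamma2 α β (m - 1))) * B3 (m - 1))
    (hD3 : ∀ m, 2 ≤ m → D3 m = A3 (m - 1) +
      Polynomial.C (1 / gamma2 α β (m - 1)) * B3 (m - 1) * (X - Polynomial.C (gamma1 α β (m - 1))))
    (δ : ℕ → Polynomial ℝ)
    (hδ : ∀ m, 2 ≤ m → A2 m * D2 m - B2 m * C2 m = rhoPoly c dd * δ m)
    (q0 : ℕ → Polynomial ℝ)
    (hq0 : ∀ m, 2 ≤ m → q0 m = (1 - X ^ 2) * (A2 m * D2 m - B2 m * C2 m))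
    (q1 q2 : ℕ → Polynomial ℝ)
    (hq1 : ∀ m, 1 ≤ m → q1 m = B3 m * A2 m - A3 m * B2 m)
    (hq2 : ∀ m, 2 ≤ m → q2 m = (1 - X ^ 2) * Polynomial.derivative (rhoPoly c dd) * δ m +
      B3 m * C2 m - A3 m * D2 m)
    (q3 q4 : ℕ → Polynomial ℝ)
    (hq3 : ∀ m, 2 ≤ m → q3 m = (1 - X ^ 2) * Polynomial.derivative (rhoPoly c dd) * δ m +
      C3 m * B2 m - D3 m * A2 m)
    (hq4 : ∀ m, 2 ≤ m → q4 m = C3 m * D2 m - D3 m * C2 m)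
    (n : ℕ) (hn : 2 ≤ n) :
    q4 (n + 1) * q0 n * S (n + 1) =
      (q3 (n + 1) * q0 n - q2 n * q0 (n + 1)) * S n +
        q1 n * q0 (n + 1) * S (n - 1) := by
  set I := jacobiFunctional α β hα hβ
  have hIeq : ∀ f g : ℝ[X], I (f * g) = ∫ x, f.eval x * g.eval x ∂(jacobiMeasure α β) := by
    intro f g
    simp only [← eval_mul]
    rfl
  have hI : ∀ f : ℝ[X], f ≠ 0 → 0 < I (f * f) := fun f hf => jacobiFunctional_mul_self_pos hα hβ hf
  have hPo' : ∀ i l, i ≠ l → I (P i * P l) = 0 := fun i l hil => by rw [hIeq, hPo i l hil]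
  have hh' : ∀ i, h i = I (P i * P i) := fun i => by simp only [hh, hIeq, sq]
  have hrec' : ∀ i, X * P (i + 1) = P (i + 2) + C (gamma1 α β (i + 1)) * P (i + 1) +
      C (gamma2 α β (i + 1)) * P i := fun i => hrec (i + 1) (by omega)
  have hγ : ∀ i, gamma2 α β (i + 1) ≠ 0 := fun i h0 => by
    have := gamma_mul_norm hPm hPd I hPo' (hrec' i)
    rw [h0, zero_mul] at this
    exact (hI _ (hPm (i + 1)).ne_zero).ne this
  have hs : α + β ≠ -1 := fun hs => hγ 0 (by
    rw [gamma2, show ((0 + 1 : ℕ) : ℝ) + α + β = 0 by push_cast; linarith]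
    simp)
  have hP0 : P 0 = 1 := (hPm 0).natDegree_eq_zero.1 (hPd 0)
  have hP1 : P 1 = X - C ((β - α) / (α + β + 2)) := by
    obtain ⟨a, ha⟩ : ∃ a, P 1 = X + C a := by
      refine ⟨(P 1).coeff 0, ?_⟩
      have := (hPm 1).as_sum
      simpa [hPd, add_comm] using this
    have h0 : α + β + 2 ≠ 0 := by linarith
    have h1 : I (P 1) = 0 := by simpa [hP0] using hPo' 1 0 one_ne_zero
    have h2 : I (C (β - α) - C (α + β + 2) * X) = 0 := jacobiFunctional_pearson hα hβ
    have h3 : (β - α + (α + β + 2) * a) * I (1 * 1) = 0 := by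
      have hpoly : (β - α + (α + β + 2) * a) • (1 * 1 : ℝ[X]) =
          (C (β - α) - C (α + β + 2) * X) + (α + β + 2) • P 1 := by
        rw [ha]
        simp only [smul_eq_C_mul, C_add, C_mul]
        ring
      rw [← smul_eq_mul, ← map_smul, hpoly, map_add, map_smul, h1, h2, smul_zero, add_zero]
    have h4 := (mul_eq_zero.1 h3).resolve_right (hI 1 one_ne_zero).ne'
    rw [ha, sub_eq_add_neg, ← C_neg]
    congr 2
    field_simp
    linarith
  have hconn : ∀ m, 1 ≤ m → rhoPoly c dd * S m = A2 m * P m + B2 m * P (m - 1) := by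
    intro m hm
    obtain ⟨m, rfl⟩ := Nat.exists_eq_add_of_le' hm
    rw [hA2 _ hm, hB2 _ hm, Nat.add_sub_cancel]
    simp only [← derivEval_apply]
    refine sobolev_connection hPm hPd I hI hPo' hh' hrec' c dd lam (hSm _) (hSd _) fun l hl => ?_
    simpa only [sobolevIP, ← hIeq, ← derivEval_apply] using hSo (m + 1) l hl
  have hconn' : ∀ m, 1 ≤ m → (1 - X ^ 2) * derivative (rhoPoly c dd * S m) =
      A3 m * P m + B3 m * P (m - 1) := by
    intro m hm
    obtain ⟨m, rfl⟩ := Nat.exists_eq_add_of_le' hm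
    obtain ⟨hst, hst'⟩ := jacobi_structure hα hβ hs hP0 hP1 hrec' m
    rw [hconn _ hm, hA3 _ hm, hB3 _ hm, Nat.add_sub_cancel]
    simp only [derivative_add, derivative_mul]
    linear_combination A2 (m + 1) * hst + B2 (m + 1) * hst'
  have hshift : ∀ m, 2 ≤ m → P (m - 2) = C (1 / gamma2 α β (m - 1)) *
      ((X - C (gamma1 α β (m - 1))) * P (m - 1) - P m) := by
    intro m hm
    obtain ⟨m, rfl⟩ := Nat.exists_eq_add_of_le' hm
    have hg : C (1 / gamma2 α β (m + 1)) * C (gamma2 α β (m + 1)) = (1 : ℝ[X]) := by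
      rw [← C_mul, one_div_mul_cancel (hγ m), C_1]
    change P m = C (1 / gamma2 α β (m + 1)) *
      ((X - C (gamma1 α β (m + 1))) * P (m + 1) - P (m + 2))
    linear_combination -C (1 / gamma2 α β (m + 1)) * hrec' m - P m * hg
  have hprev : ∀ m, 2 ≤ m → rhoPoly c dd * S (m - 1) = C2 m * P m + D2 m * P (m - 1) := by
    intro m hm
    rw [hconn _ (by omega), hC2 m hm, hD2 m hm, Nat.sub_sub, hshift m hm, C_neg]
    ring
  have hprev' : ∀ m, 2 ≤ m → (1 - X ^ 2) * derivative (rhoPoly c dd * S (m - 1)) =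
      C3 m * P m + D3 m * P (m - 1) := by
    intro m hm
    rw [hconn' _ (by omega), hC3 m hm, hD3 m hm, Nat.sub_sub, hshift m hm, C_neg]
    ring
  have hρ : rhoPoly c dd ≠ 0 :=
    (monic_prod_of_monic _ _ fun j _ => (monic_X_sub_C (c j)).pow _).ne_zero
  have hlower : q0 n * derivative (S n) + q2 n * S n = q1 n * S (n - 1) := by
    rw [hq0 n hn, hq1 n (by omega), hq2 n hn]
    exact ladder_equation hρ (hconn n (by omega)) (hprev n hn) (hconn' n (by omega)) (hδ n hn)
  have hraise : q0 (n + 1) * derivative (S n) + q3 (n + 1) * S n = q4 (n + 1) * S (n + 1) := by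
    have hn1 : 2 ≤ n + 1 := by omega
    rw [hq0 _ hn1, hq3 _ hn1, hq4 _ hn1]
    have hp := hprev _ hn1
    have hp' := hprev' _ hn1
    rw [Nat.add_sub_cancel] at hp hp'
    have hc := hconn (n + 1) (by omega)
    rw [Nat.add_sub_cancel] at hc
    have := ladder_equation (p := P n) (q := P (n + 1)) (a := D2 (n + 1)) (b := C2 (n + 1))
      (c := B2 (n + 1)) (d := A2 (n + 1)) (e := δ (n + 1)) hρ (hp.trans (add_comm _ _))
      (hc.trans (add_comm _ _)) (hp'.trans (add_comm _ _))
      (by rw [← hδ _ hn1]; ring)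
    linear_combination this
  linear_combination q0 (n + 1) * hlower - q0 n * hraise
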